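/- (Reduced Palm distribution of a Cox process is a Cox process with tilted random intensity, finite case.) Let (Ω, 𝒜, P) be a probability space and Λ : Ω × S → [0,∞) jointly measurable with ∫_S Λ(ω,u) du < ∞ for P-a.e. ω, and let f_Λ(x) = E_P[ exp(|S| − ∫_S Λ) · Π_{u ∈ x} Λ(u) ]. Let x₁,…,x_n ∈ S be pairwise distinct with 0 < E_P[Λ(x₁)⋯Λ(x_n)] < ∞. Then for every nonnegative measurable h on finite configurations, ρ^{(n)}(x₁,…,x_n) · E₀[ (f_Λ)_{x₁,…,x_n}(x) h(x) ] = E_P[ Λ(x₁)⋯Λ(x_n) · Σ_{m=0}^∞ (1/m!) e^{−∫_S Λ} ∫_{S^m} h({y₁,…,y_m}) Λ(y₁)⋯Λ(y_m) dy₁⋯dy_m ]; i.e. the reduced Palm density of f_Λ is the Cox density whose directing random field has the P-distribution of Λ tilted by Λ(x₁)⋯Λ(x_n)/E_P[Λ(x₁)⋯Λ(x_n)]. -/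

import Mathlib

open MeasureTheory ENNReal
open scoped Classical

noncomputable section

namespace PalmTutorial

/-- A finite point configuration in `ℝ^d`. -/
abbrev Config (d : ℕ) := Finset (Fin d → ℝ)

/-- The configuration `{x₁, …, x_n}` determined by a tuple `(x₁, …, x_n)`. -/
def tupCfg {d n : ℕ} (x : Fin n → (Fin d → ℝ)) : Config d :=
  Finset.image x Finset.univ

/-- The distribution of an `n`-tuple of independent uniform points: the `n`-fold product
of Lebesgue measure restricted to `S` (i.e. integration over `S^n`). -/
def restMeas (d : ℕ) (S : Set (Fin d → ℝ)) (n : ℕ) : Measure (Fin n → (Fin d → ℝ)) :=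
  Measure.pi fun _ => volume.restrict S

/-- The unit-rate Poisson expectation
`E₀[F] = Σ_{n=0}^∞ (e^{−|S|}/n!) ∫_{S^n} F({x₁,…,x_n}) dx₁⋯dx_n`. -/
def E₀ {d : ℕ} (S : Set (Fin d → ℝ)) (F : Config d → ℝ≥0∞) : ℝ≥0∞ :=
  ∑' n : ℕ, (ENNReal.ofReal (Real.exp (-(volume S).toReal)) / (Nat.factorial n : ℝ≥0∞)) *
    ∫⁻ x, F (tupCfg x) ∂(restMeas d S n)

/-- A function `F` on finite configurations is measurable if for each `n` the map
`(x₁,…,x_n) ↦ F({x₁,…,x_n})` is Borel measurable. -/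
def MeasCfg {d : ℕ} (F : Config d → ℝ≥0∞) : Prop :=
  ∀ n : ℕ, Measurable fun x : Fin n → (Fin d → ℝ) => F (tupCfg x)

/-- The `n`-th order joint intensity `ρ^{(n)}(x₁,…,x_n) = E₀[f(· ∪ {x₁,…,x_n})]`. -/
def jointIntensity {d : ℕ} (S : Set (Fin d → ℝ)) (f : Config d → ℝ≥0∞) {n : ℕ}
    (x : Fin n → (Fin d → ℝ)) : ℝ≥0∞ :=
  E₀ S fun c => f (c ∪ tupCfg x)

/-- The reduced Palm density `f_{x₁,…,x_n}(x) = f(x ∪ {x₁,…,x_n}) / ρ^{(n)}(x₁,…,x_n)`. -/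
def palmDensity {d : ℕ} (S : Set (Fin d → ℝ)) (f : Config d → ℝ≥0∞) {n : ℕ}
    (x : Fin n → (Fin d → ℝ)) (c : Config d) : ℝ≥0∞ :=
  f (c ∪ tupCfg x) / jointIntensity S f x

/-- `Σ^{≠}_{(x₁,…,x_n) ∈ c} h(x₁,…,x_n)`: the sum of `h` over all `n`-tuples of pairwise
distinct points of the configuration `c`. -/
def sumDistinct {d n : ℕ} (c : Config d) (h : (Fin n → (Fin d → ℝ)) → ℝ≥0∞) : ℝ≥0∞ :=
  ∑ x ∈ (Fintype.piFinset fun _ : Fin n => c).filter Function.Injective, h x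

/-- The density of the Cox process directed by the random intensity function `Λ`:
`f_Λ(x) = E_P[ exp(|S| − ∫_S Λ) · Π_{u ∈ x} Λ(u) ]`. -/
def coxDensity {d : ℕ} {Ω : Type*} [MeasurableSpace Ω] (P : Measure Ω)
    (S : Set (Fin d → ℝ)) (Λ : Ω → (Fin d → ℝ) → ℝ) (c : Config d) : ℝ≥0∞ :=
  ∫⁻ ω, ENNReal.ofReal (Real.exp ((volume S).toReal - ∫ u in S, Λ ω u)) *
    ∏ u ∈ c, ENNReal.ofReal (Λ ω u) ∂P

/-- Tuples sampled from a product of copies of a measure without atoms have a.e. pairwise distinct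
entries. -/
lemma ae_injective_pi {α : Type*} [MeasurableSpace α] [MeasurableEq α] (μ : Measure α)
    [SigmaFinite μ] [NullSingletonClass μ] (m : ℕ) :
    ∀ᵐ y ∂(Measure.pi fun _ : Fin m => μ), Function.Injective y := by
  have key : ∀ i j : Fin m, i ≠ j → ∀ᵐ y ∂(Measure.pi fun _ : Fin m => μ), y i ≠ y j := by
    intro i j hij
    cases m with
    | zero => exact i.elim0
    | succ m =>
      obtain ⟨k, rfl⟩ := Fin.exists_succAbove_eq hij.symm
      have hset : MeasurableSet {p : α × (Fin m → α) | p.1 = p.2 k} :=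
        measurableSet_eq_fun measurable_fst ((measurable_pi_apply k).comp measurable_snd)
      have hne : ∀ᵐ p ∂(μ.prod (Measure.pi fun _ : Fin m => μ)), p.1 ≠ p.2 k := by
        refine compl_mem_ae_iff.2 ((Measure.measure_prod_null hset).2 (.of_forall fun a => ?_))
        have := Measure.pi_hyperplane (fun _ : Fin m => μ) k a
        simpa [eq_comm] using this
      exact (measurePreserving_piFinSuccAbove (fun _ : Fin (m + 1) => μ)
        i).quasiMeasurePreserving.ae hne
  have hall : ∀ᵐ y ∂(Measure.pi fun _ : Fin m => μ), ∀ i j : Fin m, i ≠ j → y i ≠ y j := by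
    simp only [ae_all_iff]
    exact key
  filter_upwards [hall] with y hy i j hij
  by_contra hne
  exact hy i j hne hij

/-- Tonelli for a pure product integrand on a power of a measure space. -/
lemma lintegral_pi_prod_eq_pow {α : Type*} [MeasurableSpace α] (μ : Measure α) [SigmaFinite μ]
    {f : α → ℝ≥0∞} (hf : Measurable f) (m : ℕ) :
    ∫⁻ y, ∏ j, f (y j) ∂(Measure.pi fun _ : Fin m => μ) = (∫⁻ a, f a ∂μ) ^ m := by
  induction m with
  | zero => simp
  | succ m ih =>
    have hg : Measurable fun r : Fin m → α => ∏ j, f (r j) :=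
      Finset.measurable_prod _ fun j _ => hf.comp (measurable_pi_apply j)
    calc ∫⁻ y, ∏ j, f (y j) ∂(Measure.pi fun _ : Fin (m + 1) => μ)
        = ∫⁻ p, f p.1 * ∏ j, f (p.2 j) ∂(μ.prod (Measure.pi fun _ : Fin m => μ)) := by
          rw [← (measurePreserving_piFinSuccAbove (fun _ : Fin (m + 1) => μ)
            0).lintegral_comp_emb (MeasurableEquiv.measurableEmbedding _)]
          refine lintegral_congr fun y => ?_
          rw [Fin.prod_univ_succ]
          rfl
      _ = (∫⁻ a, f a ∂μ) ^ (m + 1) := by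
          rw [lintegral_prod_mul hf.aemeasurable hg.aemeasurable, ih, pow_succ']

/-- The Poisson weights sum to one. -/
lemma tsum_poisson_weights {r : ℝ} (hr : 0 ≤ r) :
    ∑' m : ℕ, ((Nat.factorial m : ℝ≥0∞))⁻¹ * ENNReal.ofReal (Real.exp (-r)) *
      ENNReal.ofReal r ^ m = 1 := by
  have hs : HasSum (fun m : ℕ => Real.exp (-r) * (r ^ m / (Nat.factorial m : ℝ))) 1 := by
    have := (NormedSpace.expSeries_div_hasSum_exp r).mul_left (Real.exp (-r))
    rwa [← Real.exp_eq_exp_ℝ, ← Real.exp_add, neg_add_cancel, Real.exp_zero] at this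
  rw [← ENNReal.ofReal_one, ← hs.tsum_eq,
    ENNReal.ofReal_tsum_of_nonneg (fun m => by positivity) hs.summable]
  refine tsum_congr fun m => ?_
  rw [ENNReal.ofReal_mul (Real.exp_nonneg _), ENNReal.ofReal_div_of_pos (by positivity),
    ENNReal.ofReal_pow hr, ENNReal.ofReal_natCast, div_eq_mul_inv]
  ring

lemma prod_tupCfg_union {d m n : ℕ} {y : Fin m → (Fin d → ℝ)} {x : Fin n → (Fin d → ℝ)}
    (hy : Function.Injective y) (hx : Function.Injective x) (hyx : ∀ i j, y i ≠ x j)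
    (f : (Fin d → ℝ) → ℝ≥0∞) :
    ∏ u ∈ tupCfg y ∪ tupCfg x, f u = (∏ i, f (y i)) * ∏ i, f (x i) := by
  have hdisj : Disjoint (tupCfg y) (tupCfg x) := by
    simp only [tupCfg, Finset.disjoint_left, Finset.mem_image, Finset.mem_univ, true_and]
    rintro _ ⟨i, rfl⟩ ⟨j, hj⟩
    exact hyx i j hj.symm
  rw [Finset.prod_union hdisj, tupCfg, tupCfg, Finset.prod_image hy.injOn,
    Finset.prod_image hx.injOn]

instance (d : ℕ) (S : Set (Fin d → ℝ)) (n : ℕ) : SigmaFinite (restMeas d S n) := by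
  unfold restMeas
  infer_instance

lemma E₀_const_mul {d : ℕ} (S : Set (Fin d → ℝ)) {r : ℝ≥0∞} (hr : r ≠ ∞)
    (F : Config d → ℝ≥0∞) : r * E₀ S F = E₀ S fun c => r * F c := by
  simp only [E₀, lintegral_const_mul' r _ hr, ← ENNReal.tsum_mul_left]
  exact tsum_congr fun m => mul_left_comm _ _ _

/-- The unnormalised form of the Palm identity for a Cox density. -/
lemma E₀_coxDensity_union_mul {d : ℕ} (hd : 1 ≤ d) (S : Set (Fin d → ℝ))
    {Ω : Type*} [MeasurableSpace Ω] (P : Measure Ω) [SFinite P]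
    (Λ : Ω → (Fin d → ℝ) → ℝ) (hΛm : Measurable (Function.uncurry Λ))
    {n : ℕ} {x : Fin n → (Fin d → ℝ)} (hx : Function.Injective x)
    {h : Config d → ℝ≥0∞} (hh : MeasCfg h) :
    E₀ S (fun c => coxDensity P S Λ (c ∪ tupCfg x) * h c) =
      ∫⁻ ω, (∏ i, ENNReal.ofReal (Λ ω (x i))) *
        ∑' m : ℕ, ((Nat.factorial m : ℝ≥0∞))⁻¹ *
          ENNReal.ofReal (Real.exp (-∫ u in S, Λ ω u)) *
          ∫⁻ y, h (tupCfg y) * ∏ j, ENNReal.ofReal (Λ ω (y j)) ∂(restMeas d S m) ∂P := by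
  have : Nonempty (Fin d) := ⟨⟨0, hd⟩⟩
  have hI : Measurable fun ω => ∫ u in S, Λ ω u :=
    (hΛm.stronglyMeasurable.integral_prod_right (ν := volume.restrict S)).measurable
  have hX : Measurable fun ω => ∏ i, ENNReal.ofReal (Λ ω (x i)) :=
    Finset.measurable_prod _ fun i _ =>
      (hΛm.comp (measurable_id.prodMk measurable_const)).ennreal_ofReal
  have hY (m : ℕ) : Measurable fun p : Ω × (Fin m → (Fin d → ℝ)) =>
      h (tupCfg p.2) * ∏ j, ENNReal.ofReal (Λ p.1 (p.2 j)) :=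
    ((hh m).comp measurable_snd).mul <| Finset.measurable_prod _ fun j _ =>
      (hΛm.comp (measurable_fst.prodMk
        ((measurable_pi_apply j).comp measurable_snd))).ennreal_ofReal
  have hYint (m : ℕ) : Measurable fun ω => ∫⁻ y, h (tupCfg y) *
      ∏ j, ENNReal.ofReal (Λ ω (y j)) ∂(restMeas d S m) :=
    (hY m).lintegral_prod_right'
  have hexp : Measurable fun ω =>
      ENNReal.ofReal (Real.exp ((volume S).toReal - ∫ u in S, Λ ω u)) :=
    (hI.const_sub _).exp.ennreal_ofReal
  have hswap (m : ℕ) : ∫⁻ y, coxDensity P S Λ (tupCfg y ∪ tupCfg x) * h (tupCfg y)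
        ∂(restMeas d S m) =
      ∫⁻ ω, ENNReal.ofReal (Real.exp ((volume S).toReal - ∫ u in S, Λ ω u)) *
        ((∏ i, ENNReal.ofReal (Λ ω (x i))) *
          ∫⁻ y, h (tupCfg y) * ∏ j, ENNReal.ofReal (Λ ω (y j)) ∂(restMeas d S m)) ∂P := by
    have hW : Measurable fun p : Ω × (Fin m → (Fin d → ℝ)) =>
        ENNReal.ofReal (Real.exp ((volume S).toReal - ∫ u in S, Λ p.1 u)) *
          ((∏ i, ENNReal.ofReal (Λ p.1 (x i))) *
            (h (tupCfg p.2) * ∏ j, ENNReal.ofReal (Λ p.1 (p.2 j)))) :=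
      (hexp.comp measurable_fst).mul ((hX.comp measurable_fst).mul (hY m))
    have hinj : ∀ᵐ y ∂(restMeas d S m), Function.Injective y := ae_injective_pi _ m
    have hne : ∀ᵐ y ∂(restMeas d S m), ∀ i j, y i ≠ x j := by
      simp only [ae_all_iff]
      exact fun i j => Measure.ae_eval_ne (fun _ : Fin m => volume.restrict S) i (x j)
    calc ∫⁻ y, coxDensity P S Λ (tupCfg y ∪ tupCfg x) * h (tupCfg y) ∂(restMeas d S m)
        = ∫⁻ y, ∫⁻ ω, ENNReal.ofReal (Real.exp ((volume S).toReal - ∫ u in S, Λ ω u)) *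
            ((∏ i, ENNReal.ofReal (Λ ω (x i))) *
              (h (tupCfg y) * ∏ j, ENNReal.ofReal (Λ ω (y j)))) ∂P ∂(restMeas d S m) := by
          refine lintegral_congr_ae ?_
          filter_upwards [hinj, hne] with y hy hyx
          have hprod : Measurable fun ω => ∏ u ∈ tupCfg y ∪ tupCfg x, ENNReal.ofReal (Λ ω u) :=
            Finset.measurable_prod _ fun u _ =>
              (hΛm.comp (measurable_id.prodMk measurable_const)).ennreal_ofReal
          rw [coxDensity, ← lintegral_mul_const]
          swap
          · exact hexp.mul hprod
          refine lintegral_congr fun ω => ?_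
          rw [prod_tupCfg_union hy hx hyx]
          ring
      _ = _ := by
          rw [lintegral_lintegral_swap]
          swap
          · exact (hW.comp measurable_swap).aemeasurable
          refine lintegral_congr fun ω => ?_
          have hYω := (hY m).comp (measurable_prodMk_left (x := ω))
          simp only [Function.comp_def] at hYω
          rw [lintegral_const_mul _ (hYω.const_mul _), lintegral_const_mul _ hYω]
  simp only [E₀, hswap, ← ENNReal.tsum_mul_left]
  rw [lintegral_tsum]
  swap
  · exact fun m => (hX.mul
      (((hI.neg.exp.ennreal_ofReal).const_mul _).mul (hYint m))).aemeasurable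
  refine tsum_congr fun m => ?_
  rw [← lintegral_const_mul]
  swap
  · exact hexp.mul (hX.mul (hYint m))
  refine lintegral_congr fun ω => ?_
  have hcomb : ENNReal.ofReal (Real.exp (-∫ u in S, Λ ω u)) =
      ENNReal.ofReal (Real.exp (-(volume S).toReal)) *
        ENNReal.ofReal (Real.exp ((volume S).toReal - ∫ u in S, Λ ω u)) := by
    rw [← ENNReal.ofReal_mul (Real.exp_nonneg _), ← Real.exp_add]
    congr 2
    ring
  rw [hcomb, div_eq_mul_inv]
  ring

/-- The joint intensity of a Cox process is the mixed moment of its directing intensity. -/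
lemma jointIntensity_coxDensity {d : ℕ} (hd : 1 ≤ d) (S : Set (Fin d → ℝ))
    {Ω : Type*} [MeasurableSpace Ω] (P : Measure Ω) [SFinite P]
    (Λ : Ω → (Fin d → ℝ) → ℝ) (hΛm : Measurable (Function.uncurry Λ))
    (hΛ0 : ∀ ω u, 0 ≤ Λ ω u) (hΛint : ∀ᵐ ω ∂P, IntegrableOn (Λ ω) S volume)
    {n : ℕ} {x : Fin n → (Fin d → ℝ)} (hx : Function.Injective x) :
    jointIntensity S (coxDensity P S Λ) x = ∫⁻ ω, ∏ i, ENNReal.ofReal (Λ ω (x i)) ∂P := by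
  have hcox := E₀_coxDensity_union_mul hd S P Λ hΛm hx (h := fun _ => 1)
    fun _ => measurable_const
  simp only [mul_one, one_mul] at hcox
  rw [jointIntensity, hcox]
  refine lintegral_congr_ae ?_
  filter_upwards [hΛint] with ω hω
  have hΛω : Measurable fun u => ENNReal.ofReal (Λ ω u) :=
    (hΛm.comp measurable_prodMk_left).ennreal_ofReal
  simp only [restMeas, lintegral_pi_prod_eq_pow _ hΛω]
  rw [← ofReal_integral_eq_lintegral_ofReal hω (.of_forall (hΛ0 ω)),
    tsum_poisson_weights (integral_nonneg (hΛ0 ω)), mul_one]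

/-- Reduced Palm distribution of a Cox process is a Cox process with tilted
random intensity, finite case. Let `x₁,…,x_n ∈ S` be pairwise distinct with
`0 < E_P[Λ(x₁)⋯Λ(x_n)] < ∞`. Then for every nonnegative measurable `h` on finite
configurations, `ρ^{(n)}(x₁,…,x_n) · E₀[ (f_Λ)_{x₁,…,x_n}(x) h(x) ]` equals
`E_P[ Λ(x₁)⋯Λ(x_n) · Σ_{m=0}^∞ (1/m!) e^{−∫_S Λ} ∫_{S^m} h({y₁,…,y_m}) Λ(y₁)⋯Λ(y_m) dy ]`,
i.e. the reduced Palm density of `f_Λ` is the Cox density whose directing random field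
has the `P`-distribution of `Λ` tilted by `Λ(x₁)⋯Λ(x_n)/E_P[Λ(x₁)⋯Λ(x_n)]`. -/
theorem statement13 {d : ℕ} (hd : 1 ≤ d) (S : Set (Fin d → ℝ)) (hSm : MeasurableSet S)
    (hSb : Bornology.IsBounded S)
    {Ω : Type*} [MeasurableSpace Ω] (P : Measure Ω) [IsProbabilityMeasure P]
    (Λ : Ω → (Fin d → ℝ) → ℝ) (hΛm : Measurable (Function.uncurry Λ))
    (hΛ0 : ∀ ω u, 0 ≤ Λ ω u) (hΛint : ∀ᵐ ω ∂P, IntegrableOn (Λ ω) S volume)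
    (n : ℕ) (hn : 1 ≤ n) (x : Fin n → (Fin d → ℝ)) (hxinj : Function.Injective x)
    (hxS : ∀ i, x i ∈ S)
    (hpos : 0 < ∫⁻ ω, ∏ i, ENNReal.ofReal (Λ ω (x i)) ∂P)
    (hfin : (∫⁻ ω, ∏ i, ENNReal.ofReal (Λ ω (x i)) ∂P) < ∞) :
    ∀ h : Config d → ℝ≥0∞, MeasCfg h →
      jointIntensity S (coxDensity P S Λ) x *
          E₀ S (fun c => palmDensity S (coxDensity P S Λ) x c * h c) =
        ∫⁻ ω, (∏ i, ENNReal.ofReal (Λ ω (x i))) *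
          ∑' m : ℕ, ((Nat.factorial m : ℝ≥0∞))⁻¹ *
            ENNReal.ofReal (Real.exp (-∫ u in S, Λ ω u)) *
            ∫⁻ y, h (tupCfg y) * ∏ j, ENNReal.ofReal (Λ ω (y j)) ∂(restMeas d S m) ∂P := by
  intro h hh
  have hρ := jointIntensity_coxDensity hd S P Λ hΛm hΛ0 hΛint hxinj
  have hρ0 : jointIntensity S (coxDensity P S Λ) x ≠ 0 := hρ ▸ hpos.ne'
  have hρt : jointIntensity S (coxDensity P S Λ) x ≠ ∞ := hρ ▸ hfin.ne
  rw [E₀_const_mul S hρt, ← E₀_coxDensity_union_mul hd S P Λ hΛm hxinj hh]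
  simp only [palmDensity, ← mul_assoc, ENNReal.mul_div_cancel hρ0 hρt]

end PalmTutorial
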